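/- arXiv:2111.07697 — 4 statements merged into one kernel-verified Lean document; each statement's English description precedes it below -/
import Mathlib

section
/- For all positive real numbers k01, k03, k11, k13, the determinant of the 4×4 real matrix with rows (0, −k01, 1, 0), (k03, 0, 0, 1), (0, k11, 1 + k11, 1 + k11/2), (−k13, −k13, −k13/2, 1 − k13/6) is nonzero. -/
/-- For all positive real numbers `k01, k03, k11, k13`, the determinant of the
4×4 real matrix with rows `(0, −k01, 1, 0)`, `(k03, 0, 0, 1)`,
`(0, k11, 1 + k11, 1 + k11/2)`, `(−k13, −k13, −k13/2, 1 − k13/6)` is nonzero. -/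
theorem det_boundary_matrix_ne_zero (k01 k03 k11 k13 : ℝ)
    (h01 : 0 < k01) (h03 : 0 < k03) (h11 : 0 < k11) (h13 : 0 < k13) :
    (!![(0 : ℝ), -k01, 1, 0;
        k03, 0, 0, 1;
        0, k11, 1 + k11, 1 + k11 / 2;
        -k13, -k13, -k13 / 2, 1 - k13 / 6]).det ≠ 0 := by
  have hdet : (!![(0 : ℝ), -k01, 1, 0;
        k03, 0, 0, 1;
        0, k11, 1 + k11, 1 + k11 / 2;
        -k13, -k13, -k13 / 2, 1 - k13 / 6]).det =
      k03 * k13 * (1 + k11 / 3 + k01 / 3 + k01 * k11 / 12) +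
        (k11 + k01 + k01 * k11) * (k13 + k03) := by
    simp [Matrix.det_succ_row_zero, Fin.sum_univ_succ, Fin.succAbove]
    ring
  rw [hdet]
  positivity
end

section
/- Let k01, k03, k11, k13 > 0 and k02, k04, k12, k14 ≥ 0 be real numbers. For every continuous function f : [0,1] → ℂ and every (a, b, c, d) ∈ ℂ⁴ there exists a unique four times continuously differentiable function v : [0,1] → ℂ such that v''''(s) = f(s) for all s ∈ [0,1] and v''(0) − k01 v'(0) = k02 a, −v'''(0) − k03 v(0) = k04 b, −v''(1) − k11 v'(1) = k12 c, v'''(1) − k13 v(1) = k14 d. -/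
open Set

/-- A solution of the boundary-value problem `v'''' = f` on `[0,1]` with the viscoelastic
boundary conditions. -/
def IsBVPSol (k01 k02 k03 k04 k11 k12 k13 k14 : ℝ) (f : ℝ → ℂ) (a b c d : ℂ)
    (v : ℝ → ℂ) : Prop :=
  ContDiff ℝ 4 v ∧
  (∀ s ∈ Icc (0 : ℝ) 1, iteratedDeriv 4 v s = f s) ∧
  iteratedDeriv 2 v 0 - k01 * deriv v 0 = k02 * a ∧
  -iteratedDeriv 3 v 0 - k03 * v 0 = k04 * b ∧
  -iteratedDeriv 2 v 1 - k11 * deriv v 1 = k12 * c ∧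
  iteratedDeriv 3 v 1 - k13 * v 1 = k14 * d

/-- The determinant of the boundary-value problem, after eliminating the second and third
derivatives at `0`. -/
noncomputable def bvpDet (k01 k03 k11 k13 : ℝ) : ℝ :=
  k03 * (1 + k11 / 2) * (k13 * (1 + k01 / 2)) +
    (k01 + k11 + k11 * k01) * (k03 + k13 - k13 * k03 / 6)

theorem bvpDet_pos {k01 k03 k11 k13 : ℝ} (h01 : 0 < k01) (h03 : 0 < k03) (h11 : 0 < k11)
    (h13 : 0 < k13) : 0 < bvpDet k01 k03 k11 k13 := by
  have h : bvpDet k01 k03 k11 k13 = k03 * k13 * (1 + k11 / 3 + k01 / 3 + k01 * k11 / 12) +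
      (k01 + k11 + k11 * k01) * (k03 + k13) := by
    unfold bvpDet; ring
  rw [h]; positivity

/-- The boundary conditions determine the coefficients of the cubic part of a solution. -/
theorem exists_cubic_coeffs {k01 k03 k11 k13 : ℝ} (hdet : bvpDet k01 k03 k11 k13 ≠ 0)
    (α β γ δ p₀ p₁ p₂ p₃ : ℂ) :
    ∃ A B C D : ℂ, C - k01 * B = α ∧ -D - k03 * A = β ∧
      -(C + D + p₂) - k11 * (B + C + D / 2 + p₁) = γ ∧
      (D + p₃) - k13 * (A + B + C / 2 + D / 6 + p₀) = δ := by
  have hE : ((bvpDet k01 k03 k11 k13 : ℝ) : ℂ) ≠ 0 := by exact_mod_cast hdet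
  obtain ⟨E, hEdef⟩ : ∃ E : ℂ, E = ((bvpDet k01 k03 k11 k13 : ℝ) : ℂ) := ⟨_, rfl⟩
  rw [← hEdef] at hE
  simp only [bvpDet] at hEdef
  push_cast at hEdef
  obtain ⟨r₁, hr₁⟩ : ∃ r : ℂ, r = γ + (α - β + p₂) + k11 * (α - β / 2 + p₁) := ⟨_, rfl⟩
  obtain ⟨r₂, hr₂⟩ : ∃ r : ℂ, r = -β + p₃ - k13 * (α / 2 - β / 6 + p₀) - δ := ⟨_, rfl⟩
  obtain ⟨A, hA⟩ : ∃ A : ℂ,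
      A = (k13 * (1 + k01 / 2) * r₁ + (k01 + k11 + k11 * k01) * r₂) / E := ⟨_, rfl⟩
  obtain ⟨B, hB⟩ : ∃ B : ℂ,
      B = (k03 * (1 + k11 / 2) * r₂ - (k03 + k13 - k13 * k03 / 6) * r₁) / E := ⟨_, rfl⟩
  rw [eq_div_iff hE] at hA hB
  have h₁ : k03 * (1 + k11 / 2) * A - (k01 + k11 + k11 * k01) * B = r₁ := by
    apply mul_right_cancel₀ hE
    linear_combination (k03 * (1 + k11 / 2) : ℂ) * hA - (k01 + k11 + k11 * k01 : ℂ) * hB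
      - r₁ * hEdef
  have h₂ : (k03 + k13 - k13 * k03 / 6) * A + k13 * (1 + k01 / 2) * B = r₂ := by
    apply mul_right_cancel₀ hE
    linear_combination (k03 + k13 - k13 * k03 / 6 : ℂ) * hA + (k13 * (1 + k01 / 2) : ℂ) * hB
      - r₂ * hEdef
  refine ⟨A, B, α + k01 * B, -β - k03 * A, by ring, by ring, ?_, ?_⟩
  · linear_combination h₁ + hr₁
  · linear_combination -h₂ - hr₂

/-- The homogeneous boundary conditions force a cubic to vanish. -/
theorem cubic_coeffs_eq_zero {k01 k03 k11 k13 : ℝ} (hdet : bvpDet k01 k03 k11 k13 ≠ 0)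
    {A B C D : ℂ} (h₁ : C - k01 * B = 0) (h₂ : -D - k03 * A = 0)
    (h₃ : -(C + D) - k11 * (B + C + D / 2) = 0)
    (h₄ : D - k13 * (A + B + C / 2 + D / 6) = 0) : A = 0 ∧ B = 0 ∧ C = 0 ∧ D = 0 := by
  have hE : ((bvpDet k01 k03 k11 k13 : ℝ) : ℂ) ≠ 0 := by exact_mod_cast hdet
  obtain rfl : C = k01 * B := by linear_combination h₁
  obtain rfl : D = -(k03 * A) := by linear_combination -h₂
  have hA : A = 0 := by
    apply (mul_eq_zero.1 _).resolve_left hE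
    simp only [bvpDet]
    push_cast
    linear_combination (k13 * (1 + k01 / 2) : ℂ) * h₃ - (k01 + k11 + k11 * k01 : ℂ) * h₄
  have hB : B = 0 := by
    apply (mul_eq_zero.1 _).resolve_left hE
    simp only [bvpDet]
    push_cast
    linear_combination -(k03 * (1 + k11 / 2) : ℂ) * h₄ - (k03 + k13 - k13 * k03 / 6 : ℂ) * h₃
  simp [hA, hB]

theorem hasDerivAt_iteratedDeriv_of_contDiff {n : WithTop ℕ∞} {v : ℝ → ℂ} (hv : ContDiff ℝ n v)
    {m : ℕ} (hm : (m : WithTop ℕ∞) < n) (s : ℝ) :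
    HasDerivAt (iteratedDeriv m v) (iteratedDeriv (m + 1) v s) s := by
  rw [iteratedDeriv_succ]
  exact (hv.differentiable_iteratedDeriv m hm s).hasDerivAt

theorem eqOn_Icc_of_hasDerivAt_eq {u w u' w' : ℝ → ℂ} (hu : ∀ s, HasDerivAt u (u' s) s)
    (hw : ∀ s, HasDerivAt w (w' s) s) (h : EqOn u' w' (Icc 0 1)) (h0 : u 0 = w 0) :
    EqOn u w (Icc 0 1) := by
  refine eq_of_has_deriv_right_eq (f' := u') (fun x _ => (hu x).hasDerivWithinAt)
    (fun x hx => ?_) (fun x _ => (hu x).continuousAt.continuousWithinAt)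
    (fun x _ => (hw x).continuousAt.continuousWithinAt) h0
  rw [h (Ico_subset_Icc_self hx)]
  exact (hw x).hasDerivWithinAt

/-- The cubic with prescribed derivatives at `0`, as a function of a real variable. -/
noncomputable def taylorCubic (A B C D : ℂ) (s : ℝ) : ℂ := A + B * s + C / 2 * s ^ 2 + D / 6 * s ^ 3

theorem hasDerivAt_taylorCubic (A B C D : ℂ) (s : ℝ) :
    HasDerivAt (taylorCubic A B C D) (taylorCubic B C D 0 s) s := by
  have h : HasDerivAt (fun t : ℝ => (t : ℂ)) 1 s := Complex.ofRealCLM.hasDerivAt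
  have := ((((hasDerivAt_const s A).add (h.const_mul B)).add ((h.pow 2).const_mul (C / 2))).add
    ((h.pow 3).const_mul (D / 6)))
  refine this.congr_deriv ?_
  simp only [taylorCubic]
  push_cast
  ring

theorem taylorCubic_at_zero (A B C D : ℂ) : taylorCubic A B C D 0 = A := by
  simp [taylorCubic]

theorem exists_primitive_at_zero {g : ℝ → ℂ} (hg : Continuous g) :
    ∃ G : ℝ → ℂ, Continuous G ∧ G 0 = 0 ∧ ∀ s, HasDerivAt G (g s) s := by
  have h : ∀ s, HasDerivAt (fun t => ∫ x in (0 : ℝ)..t, g x) (g s) s := fun s =>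
    intervalIntegral.integral_hasDerivAt_right (hg.intervalIntegrable _ _)
      hg.stronglyMeasurable.stronglyMeasurableAtFilter hg.continuousAt
  exact ⟨_, continuous_iff_continuousAt.2 fun s => (h s).continuousAt, by simp, h⟩

theorem iteratedDeriv_of_hasDerivAt_chain {v₀ v₁ v₂ v₃ v₄ : ℝ → ℂ}
    (h₀ : ∀ s, HasDerivAt v₀ (v₁ s) s) (h₁ : ∀ s, HasDerivAt v₁ (v₂ s) s)
    (h₂ : ∀ s, HasDerivAt v₂ (v₃ s) s) (h₃ : ∀ s, HasDerivAt v₃ (v₄ s) s) :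
    deriv v₀ = v₁ ∧ iteratedDeriv 2 v₀ = v₂ ∧ iteratedDeriv 3 v₀ = v₃ ∧
      iteratedDeriv 4 v₀ = v₄ := by
  have e₁ : deriv v₀ = v₁ := funext fun s => (h₀ s).deriv
  have e₂ : iteratedDeriv 2 v₀ = v₂ := by
    rw [iteratedDeriv_succ, iteratedDeriv_one, e₁]; exact funext fun s => (h₁ s).deriv
  have e₃ : iteratedDeriv 3 v₀ = v₃ := by
    rw [iteratedDeriv_succ, e₂]; exact funext fun s => (h₂ s).deriv
  refine ⟨e₁, e₂, e₃, ?_⟩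
  rw [iteratedDeriv_succ, e₃]; exact funext fun s => (h₃ s).deriv

theorem contDiff_succ_of_hasDerivAt {n : ℕ} {v v' : ℝ → ℂ} (h : ∀ s, HasDerivAt v (v' s) s)
    (hv' : ContDiff ℝ n v') : ContDiff ℝ (n + 1 : ℕ) v := by
  have e : deriv v = v' := funext fun s => (h s).deriv
  push_cast
  exact contDiff_succ_iff_deriv.2
    ⟨fun s => (h s).differentiableAt, fun hn => by simp at hn, e ▸ hv'⟩

/-- Existence part of the boundary-value problem. -/
theorem exists_isBVPSol {k01 k03 k11 k13 : ℝ} (hdet : bvpDet k01 k03 k11 k13 ≠ 0)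
    (k02 k04 k12 k14 : ℝ) {f : ℝ → ℂ} (hf : ContinuousOn f (Icc 0 1)) (a b c d : ℂ) :
    ∃ v : ℝ → ℂ, IsBVPSol k01 k02 k03 k04 k11 k12 k13 k14 f a b c d v := by
  obtain ⟨g, hg, hgf⟩ : ∃ g : ℝ → ℂ, Continuous g ∧ EqOn g f (Icc 0 1) :=
    ⟨IccExtend zero_le_one ((Icc 0 1).domRestrict f), hf.domRestrict.Icc_extend', fun s hs => by
      simp [IccExtend_of_mem zero_le_one _ hs]⟩
  obtain ⟨P₃, hc₃, hz₃, hP₃⟩ := exists_primitive_at_zero hg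
  obtain ⟨P₂, hc₂, hz₂, hP₂⟩ := exists_primitive_at_zero hc₃
  obtain ⟨P₁, hc₁, hz₁, hP₁⟩ := exists_primitive_at_zero hc₂
  obtain ⟨P₀, -, hz₀, hP₀⟩ := exists_primitive_at_zero hc₁
  obtain ⟨A, B, C, D, e₁, e₂, e₃, e₄⟩ := exists_cubic_coeffs hdet (k02 * a) (k04 * b)
    (k12 * c) (k14 * d) (P₀ 1) (P₁ 1) (P₂ 1) (P₃ 1)
  have h₀ := fun s => (hP₀ s).add (hasDerivAt_taylorCubic A B C D s)
  have h₁ := fun s => (hP₁ s).add (hasDerivAt_taylorCubic B C D 0 s)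
  have h₂ := fun s => (hP₂ s).add (hasDerivAt_taylorCubic C D 0 0 s)
  have h₃ := fun s => (hP₃ s).add (hasDerivAt_taylorCubic D 0 0 0 s)
  have hz : taylorCubic 0 0 0 0 = 0 := by ext; simp [taylorCubic]
  simp only [hz, Pi.zero_apply, add_zero] at h₃
  obtain ⟨d₁, d₂, d₃, d₄⟩ := iteratedDeriv_of_hasDerivAt_chain h₀ h₁ h₂ h₃
  refine ⟨P₀ + taylorCubic A B C D, ?_, ?_, ?_⟩
  · have hg0 : ContDiff ℝ (0 : ℕ) g := by exact_mod_cast contDiff_zero.2 hg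
    exact contDiff_succ_of_hasDerivAt h₀ (contDiff_succ_of_hasDerivAt h₁
      (contDiff_succ_of_hasDerivAt h₂ (contDiff_succ_of_hasDerivAt h₃ hg0)))
  · intro s hs
    rw [d₄, hgf hs]
  · rw [d₁, d₂, d₃]
    simp only [Pi.add_apply, taylorCubic_at_zero, hz₀, hz₁, hz₂, hz₃, zero_add]
    refine ⟨e₁, e₂, ?_, ?_⟩
    · simp only [taylorCubic]
      push_cast
      linear_combination e₃
    · simp only [taylorCubic]
      push_cast
      linear_combination e₄

/-- Uniqueness part of the boundary-value problem. -/
theorem IsBVPSol.eqOn {k01 k02 k03 k04 k11 k12 k13 k14 : ℝ} {f v₁ v₂ : ℝ → ℂ} {a b c d : ℂ}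
    (hdet : bvpDet k01 k03 k11 k13 ≠ 0)
    (hv₁ : IsBVPSol k01 k02 k03 k04 k11 k12 k13 k14 f a b c d v₁)
    (hv₂ : IsBVPSol k01 k02 k03 k04 k11 k12 k13 k14 f a b c d v₂) : EqOn v₁ v₂ (Icc 0 1) := by
  obtain ⟨c₁, f₁, p₁, q₁, r₁, s₁⟩ := hv₁
  obtain ⟨c₂, f₂, p₂, q₂, r₂, s₂⟩ := hv₂
  obtain ⟨w, hw⟩ : ∃ w : ℕ → ℝ → ℂ, w = fun m => iteratedDeriv m v₁ - iteratedDeriv m v₂ :=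
    ⟨_, rfl⟩
  have hwd : ∀ m : ℕ, m < 4 → ∀ s, HasDerivAt (w m) (w (m + 1) s) s := fun m hm s => by
    rw [hw]
    exact (hasDerivAt_iteratedDeriv_of_contDiff c₁ (by exact_mod_cast hm) s).sub
      (hasDerivAt_iteratedDeriv_of_contDiff c₂ (by exact_mod_cast hm) s)
  have E₄ : EqOn (w 4) (taylorCubic 0 0 0 0) (Icc 0 1) := fun s hs => by
    simp [hw, taylorCubic, f₁ s hs, f₂ s hs]
  have step : ∀ (m : ℕ) (B C D : ℂ), m < 4 → EqOn (w (m + 1)) (taylorCubic B C D 0) (Icc 0 1) →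
      EqOn (w m) (taylorCubic (w m 0) B C D) (Icc 0 1) := fun m B C D hm h =>
    eqOn_Icc_of_hasDerivAt_eq (hwd m hm) (hasDerivAt_taylorCubic _ B C D) h
      (taylorCubic_at_zero _ _ _ _).symm
  have E₃ := step 3 _ _ _ (by norm_num) E₄
  have E₂ := step 2 _ _ _ (by norm_num) E₃
  have E₁ := step 1 _ _ _ (by norm_num) E₂
  have E₀ := step 0 _ _ _ (by norm_num) E₁
  have one_mem : (1 : ℝ) ∈ Icc (0 : ℝ) 1 := right_mem_Icc.2 zero_le_one
  have t₃ := E₃ one_mem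
  have t₂ := E₂ one_mem
  have t₁ := E₁ one_mem
  have t₀ := E₀ one_mem
  have w0 : ∀ s, w 0 s = v₁ s - v₂ s := fun s => by simp [hw]
  have w1 : ∀ s, w 1 s = deriv v₁ s - deriv v₂ s := fun s => by simp [hw]
  have w2 : ∀ s, w 2 s = iteratedDeriv 2 v₁ s - iteratedDeriv 2 v₂ s := fun s => by simp [hw]
  have w3 : ∀ s, w 3 s = iteratedDeriv 3 v₁ s - iteratedDeriv 3 v₂ s := fun s => by simp [hw]
  simp only [taylorCubic] at t₀ t₁ t₂ t₃
  push_cast at t₀ t₁ t₂ t₃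
  obtain ⟨hA, hB, hC, hD⟩ := cubic_coeffs_eq_zero hdet (A := w 0 0) (B := w 1 0) (C := w 2 0)
    (D := w 3 0) (by linear_combination p₁ - p₂ + w2 0 - k01 * w1 0)
    (by linear_combination q₁ - q₂ - w3 0 - k03 * w0 0)
    (by linear_combination r₁ - r₂ - w2 1 - k11 * w1 1 + t₂ + k11 * t₁)
    (by linear_combination s₁ - s₂ + w3 1 - k13 * w0 1 - t₃ + k13 * t₀)
  intro s hs
  have := E₀ hs
  rw [hA, hB, hC, hD, w0] at this
  simpa [taylorCubic, sub_eq_zero] using this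

/-- existence and uniqueness (on `[0,1]`) of a four times continuously
differentiable solution `v` of `v'''' = f` subject to the generalised boundary conditions
`v''(0) − k01 v'(0) = k02 a`, `−v'''(0) − k03 v(0) = k04 b`,
`−v''(1) − k11 v'(1) = k12 c`, `v'''(1) − k13 v(1) = k14 d`. -/
theorem bvp_exists_unique (k01 k02 k03 k04 k11 k12 k13 k14 : ℝ)
    (h01 : 0 < k01) (h03 : 0 < k03) (h11 : 0 < k11) (h13 : 0 < k13)
    (h02 : 0 ≤ k02) (h04 : 0 ≤ k04) (h12 : 0 ≤ k12) (h14 : 0 ≤ k14)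
    (f : ℝ → ℂ) (hf : ContinuousOn f (Icc 0 1)) (a b c d : ℂ) :
    (∃ v : ℝ → ℂ, IsBVPSol k01 k02 k03 k04 k11 k12 k13 k14 f a b c d v) ∧
    (∀ v₁ v₂ : ℝ → ℂ, IsBVPSol k01 k02 k03 k04 k11 k12 k13 k14 f a b c d v₁ →
      IsBVPSol k01 k02 k03 k04 k11 k12 k13 k14 f a b c d v₂ →
      EqOn v₁ v₂ (Icc 0 1)) := by
  have hdet := (bvpDet_pos h01 h03 h11 h13).ne'
  exact ⟨exists_isBVPSol hdet k02 k04 k12 k14 hf a b c d, fun _ _ h₁ h₂ => h₁.eqOn hdet h₂⟩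
end

section
/- Let α > 0, δ ≥ 0 and k01, k02, k03, k04, k11, k12, k13, k14 ≥ 0 be real numbers. For every w ∈ C²([0,1],ℂ) and v ∈ C⁴([0,1],ℂ), set ŵ = (v − w)/α and v̂ = −α v'''' − ((αδ − 1)/α)(v − w). Then Re[ α² ((ŵ, w))₂ + ∫₀¹ (v̂(s) − ŵ(s)) · conj(v(s) − w(s)) ds + α ⟨u − MΓŵ, Γv − Γw⟩ ] = −α ∫₀¹ |v''(s) − w''(s)|² ds − δ ∫₀¹ |v(s) − w(s)|² ds − (k04 + α k03)|v(0) − w(0)|² − (k02 + α k01)|v'(0) − w'(0)|² − (k14 + α k13)|v(1) − w(1)|² − (k12 + α k11)|v'(1) − w'(1)|², where u = (v''(0) − k01 v'(0), −v'''(0) − k03 v(0), −v''(1) − k11 v'(1), v'''(1) − k13 v(1)) ∈ ℂ⁴. In particular the left-hand side is ≤ 0. -/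
open Set ComplexConjugate

/-- `ŵ = (v − w)/α`. -/
noncomputable def wHat (α : ℝ) (w v : ℝ → ℂ) : ℝ → ℂ := fun s => (v s - w s) / α

/-- `v̂ = −α v'''' − ((αδ − 1)/α)(v − w)`. -/
noncomputable def vHat (α δ : ℝ) (w v : ℝ → ℂ) : ℝ → ℂ :=
  fun s => -α * iteratedDeriv 4 v s - ((α * δ - 1) / α) * (v s - w s)

/-- Integrating by parts twice: Green's formula for the fourth derivative. -/
lemma integral_iteratedDeriv_four_mul_conj {a b : ℝ} {f g : ℝ → ℂ}
    (hf : ContDiff ℝ 4 f) (hg : ContDiff ℝ 2 g) :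
    ∫ s in a..b, iteratedDeriv 4 f s * conj (g s)
      = iteratedDeriv 3 f b * conj (g b) - iteratedDeriv 3 f a * conj (g a)
        - (iteratedDeriv 2 f b * conj (deriv g b) - iteratedDeriv 2 f a * conj (deriv g a))
        + ∫ s in a..b, iteratedDeriv 2 f s * conj (iteratedDeriv 2 g s) := by
  have hf3 (s : ℝ) : HasDerivAt (iteratedDeriv 3 f) (iteratedDeriv 4 f s) s := by
    rw [iteratedDeriv_succ (n := 3)]
    exact (hf.differentiable_iteratedDeriv 3 (by norm_num) s).hasDerivAt
  have hf2 (s : ℝ) : HasDerivAt (iteratedDeriv 2 f) (iteratedDeriv 3 f s) s := by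
    rw [iteratedDeriv_succ (n := 2)]
    exact (hf.differentiable_iteratedDeriv 2 (by norm_num) s).hasDerivAt
  have hg0 (s : ℝ) : HasDerivAt (fun t => conj (g t)) (conj (deriv g s)) s :=
    (hg.differentiable (by norm_num) s).hasDerivAt.star
  have hg1 (s : ℝ) :
      HasDerivAt (fun t => conj (deriv g t)) (conj (iteratedDeriv 2 g s)) s := by
    have h := hg.differentiable_iteratedDeriv 1 (by norm_num) s
    rw [iteratedDeriv_succ (n := 1), iteratedDeriv_one] at *
    exact h.hasDerivAt.star
  have cf4 := hf.continuous_iteratedDeriv 4 le_rfl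
  have cf3 := hf.continuous_iteratedDeriv 3 (by norm_num)
  have cg1 : Continuous fun s => conj (deriv g s) :=
    Complex.continuous_conj.comp (hg.continuous_deriv (by norm_num))
  have cg2 : Continuous fun s => conj (iteratedDeriv 2 g s) :=
    Complex.continuous_conj.comp (hg.continuous_iteratedDeriv 2 le_rfl)
  have parts₁ := intervalIntegral.integral_mul_deriv_eq_deriv_mul (fun s _ => hf3 s)
    (fun s _ => hg0 s) (cf4.intervalIntegrable a b) (cg1.intervalIntegrable a b)
  have parts₂ := intervalIntegral.integral_mul_deriv_eq_deriv_mul (fun s _ => hf2 s)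
    (fun s _ => hg1 s) (cf3.intervalIntegrable a b) (cg2.intervalIntegrable a b)
  linear_combination parts₁ - parts₂

lemma intervalIntegral_mul_conj_self (a b : ℝ) (f : ℝ → ℂ) :
    ∫ s in a..b, f s * conj (f s) = ((∫ s in a..b, ‖f s‖ ^ 2 : ℝ) : ℂ) := by
  simp_rw [Complex.mul_conj', ← Complex.ofReal_pow]
  exact intervalIntegral.integral_ofReal

lemma re_mul_conj_sub_mul_conj (x y : ℂ) :
    ((x - y) * conj y - x * conj (x - y)).re = -‖x - y‖ ^ 2 := by
  rw [← Complex.normSq_eq_norm_sq, Complex.normSq_apply]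
  simp
  ring

/-- the dissipativity identity `Re⟨A₀x, x⟩ ≤ 0` for the operator `A₀`
associated with a viscoelastic tube conveying fluid. -/
theorem dissipativity_identity (α δ k01 k02 k03 k04 k11 k12 k13 k14 : ℝ)
    (hα : 0 < α) (hδ : 0 ≤ δ)
    (h01 : 0 ≤ k01) (h02 : 0 ≤ k02) (h03 : 0 ≤ k03) (h04 : 0 ≤ k04)
    (h11 : 0 ≤ k11) (h12 : 0 ≤ k12) (h13 : 0 ≤ k13) (h14 : 0 ≤ k14)
    (w v : ℝ → ℂ) (hw : ContDiff ℝ 2 w) (hv : ContDiff ℝ 4 v) :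
    (α ^ 2 * ((∫ s in (0 : ℝ)..1,
            iteratedDeriv 2 (wHat α w v) s * conj (iteratedDeriv 2 w s))
          + k03 * wHat α w v 0 * conj (w 0)
          + k01 * deriv (wHat α w v) 0 * conj (deriv w 0)
          + k13 * wHat α w v 1 * conj (w 1)
          + k11 * deriv (wHat α w v) 1 * conj (deriv w 1))
        + (∫ s in (0 : ℝ)..1, (vHat α δ w v s - wHat α w v s) * conj (v s - w s))
        + α * ((iteratedDeriv 2 v 0 - k01 * deriv v 0 - k02 * deriv (wHat α w v) 0)
              * conj (deriv v 0 - deriv w 0)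
            + (-iteratedDeriv 3 v 0 - k03 * v 0 - k04 * wHat α w v 0)
              * conj (v 0 - w 0)
            + (-iteratedDeriv 2 v 1 - k11 * deriv v 1 - k12 * deriv (wHat α w v) 1)
              * conj (deriv v 1 - deriv w 1)
            + (iteratedDeriv 3 v 1 - k13 * v 1 - k14 * wHat α w v 1)
              * conj (v 1 - w 1))).re
      = -α * (∫ s in (0 : ℝ)..1, ‖iteratedDeriv 2 v s - iteratedDeriv 2 w s‖ ^ 2)
        - δ * (∫ s in (0 : ℝ)..1, ‖v s - w s‖ ^ 2)
        - (k04 + α * k03) * ‖v 0 - w 0‖ ^ 2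
        - (k02 + α * k01) * ‖deriv v 0 - deriv w 0‖ ^ 2
        - (k14 + α * k13) * ‖v 1 - w 1‖ ^ 2
        - (k12 + α * k11) * ‖deriv v 1 - deriv w 1‖ ^ 2
    ∧
    (α ^ 2 * ((∫ s in (0 : ℝ)..1,
            iteratedDeriv 2 (wHat α w v) s * conj (iteratedDeriv 2 w s))
          + k03 * wHat α w v 0 * conj (w 0)
          + k01 * deriv (wHat α w v) 0 * conj (deriv w 0)
          + k13 * wHat α w v 1 * conj (w 1)
          + k11 * deriv (wHat α w v) 1 * conj (deriv w 1))
        + (∫ s in (0 : ℝ)..1, (vHat α δ w v s - wHat α w v s) * conj (v s - w s))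
        + α * ((iteratedDeriv 2 v 0 - k01 * deriv v 0 - k02 * deriv (wHat α w v) 0)
              * conj (deriv v 0 - deriv w 0)
            + (-iteratedDeriv 3 v 0 - k03 * v 0 - k04 * wHat α w v 0)
              * conj (v 0 - w 0)
            + (-iteratedDeriv 2 v 1 - k11 * deriv v 1 - k12 * deriv (wHat α w v) 1)
              * conj (deriv v 1 - deriv w 1)
            + (iteratedDeriv 3 v 1 - k13 * v 1 - k14 * wHat α w v 1)
              * conj (v 1 - w 1))).re ≤ 0 := by
  have hα' : (α : ℂ) ≠ 0 := by exact_mod_cast hα.ne'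
  have hz : ContDiff ℝ 2 (fun s => v s - w s) := (hv.of_le (by norm_num)).sub hw
  have dz (s : ℝ) : deriv (fun s => v s - w s) s = deriv v s - deriv w s :=
    deriv_fun_sub (hv.differentiable (by norm_num) s) (hw.differentiable (by norm_num) s)
  have dz2 (s : ℝ) : iteratedDeriv 2 (fun s => v s - w s) s
      = iteratedDeriv 2 v s - iteratedDeriv 2 w s :=
    iteratedDeriv_fun_sub (hv.of_le (by norm_num)).contDiffAt hw.contDiffAt
  have dwHat (s : ℝ) : deriv (wHat α w v) s = (deriv v s - deriv w s) / α := by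
    unfold wHat
    rw [deriv_div_const, dz]
  have dwHat2 (s : ℝ) : iteratedDeriv 2 (wHat α w v) s
      = (iteratedDeriv 2 v s - iteratedDeriv 2 w s) / α := by
    unfold wHat
    rw [← dz2]
    simp only [div_eq_inv_mul]
    exact iteratedDeriv_const_mul_field _ _
  have cv2 := hv.continuous_iteratedDeriv 2 (by norm_num)
  have cv4 := hv.continuous_iteratedDeriv 4 le_rfl
  have cw2 := hw.continuous_iteratedDeriv 2 le_rfl
  have cz := hz.continuous
  have hbending : ∫ s in (0 : ℝ)..1, iteratedDeriv 2 (wHat α w v) s * conj (iteratedDeriv 2 w s)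
      = (∫ s in (0 : ℝ)..1,
          (iteratedDeriv 2 v s - iteratedDeriv 2 w s) * conj (iteratedDeriv 2 w s)) / α := by
    rw [← intervalIntegral.integral_div]
    simp only [dwHat2, div_mul_eq_mul_div]
  have hkinetic : ∫ s in (0 : ℝ)..1, (vHat α δ w v s - wHat α w v s) * conj (v s - w s)
      = -α * (∫ s in (0 : ℝ)..1, iteratedDeriv 4 v s * conj (v s - w s))
        - δ * ∫ s in (0 : ℝ)..1, (v s - w s) * conj (v s - w s) := by
    rw [← intervalIntegral.integral_const_mul, ← intervalIntegral.integral_const_mul,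
      ← intervalIntegral.integral_sub]
    · congr 1 with s
      unfold vHat wHat
      field_simp
      ring
    · exact (continuous_const.mul
        (cv4.mul (Complex.continuous_conj.comp cz))).intervalIntegrable _ _
    · exact (continuous_const.mul
        (cz.mul (Complex.continuous_conj.comp cz))).intervalIntegrable _ _
  have hcross : (∫ s in (0 : ℝ)..1,
        (iteratedDeriv 2 v s - iteratedDeriv 2 w s) * conj (iteratedDeriv 2 w s)).re
      - (∫ s in (0 : ℝ)..1,
        iteratedDeriv 2 v s * conj (iteratedDeriv 2 v s - iteratedDeriv 2 w s)).re
      = -∫ s in (0 : ℝ)..1, ‖iteratedDeriv 2 v s - iteratedDeriv 2 w s‖ ^ 2 := by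
    have hi₁ : IntervalIntegrable (fun s => (iteratedDeriv 2 v s - iteratedDeriv 2 w s)
        * conj (iteratedDeriv 2 w s)) MeasureTheory.volume 0 1 :=
      ((cv2.sub cw2).mul (Complex.continuous_conj.comp cw2)).intervalIntegrable _ _
    have hi₂ : IntervalIntegrable (fun s => iteratedDeriv 2 v s
        * conj (iteratedDeriv 2 v s - iteratedDeriv 2 w s)) MeasureTheory.volume 0 1 :=
      (cv2.mul (Complex.continuous_conj.comp (cv2.sub cw2))).intervalIntegrable _ _
    rw [← Complex.sub_re, ← intervalIntegral.integral_sub hi₁ hi₂, ← Complex.reCLM_apply,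
      ← Complex.reCLM.intervalIntegral_comp_comm (hi₁.sub hi₂), ← intervalIntegral.integral_neg]
    simp only [Complex.reCLM_apply, re_mul_conj_sub_mul_conj]
  have hgreen := integral_iteratedDeriv_four_mul_conj (a := 0) (b := 1) hv hz
  simp only [dz, dz2] at hgreen
  refine (and_iff_left_of_imp fun h => h.trans_le ?_).mpr ?_
  · rw [hbending, hkinetic, hgreen, intervalIntegral_mul_conj_self]
    simp only [dwHat, wHat]
    generalize (∫ s in (0 : ℝ)..1,
      (iteratedDeriv 2 v s - iteratedDeriv 2 w s) * conj (iteratedDeriv 2 w s)) = P at *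
    generalize (∫ s in (0 : ℝ)..1,
      iteratedDeriv 2 v s * conj (iteratedDeriv 2 v s - iteratedDeriv 2 w s)) = Q at *
    let E (x y : ℂ) : ℂ := (x - y) * conj y - x * conj (x - y)
    have hE (x y : ℂ) : (E x y).re = -‖x - y‖ ^ 2 := re_mul_conj_sub_mul_conj x y
    have hN (x y : ℂ) : (x - y) * conj (x - y) = ((‖x - y‖ ^ 2 : ℝ) : ℂ) := by
      rw [Complex.mul_conj', Complex.ofReal_pow]
    trans ((α : ℂ) * (P - Q) - ((δ * ∫ s in (0 : ℝ)..1, ‖v s - w s‖ ^ 2 : ℝ) : ℂ)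
      + ((α * k03 : ℝ) : ℂ) * E (v 0) (w 0) - ((k04 * ‖v 0 - w 0‖ ^ 2 : ℝ) : ℂ)
      + ((α * k01 : ℝ) : ℂ) * E (deriv v 0) (deriv w 0)
      - ((k02 * ‖deriv v 0 - deriv w 0‖ ^ 2 : ℝ) : ℂ)
      + ((α * k13 : ℝ) : ℂ) * E (v 1) (w 1) - ((k14 * ‖v 1 - w 1‖ ^ 2 : ℝ) : ℂ)
      + ((α * k11 : ℝ) : ℂ) * E (deriv v 1) (deriv w 1)
      - ((k12 * ‖deriv v 1 - deriv w 1‖ ^ 2 : ℝ) : ℂ)).re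
    · congr 1
      simp only [Complex.ofReal_mul, ← hN, E]
      field_simp
      ring
    · simp only [Complex.add_re, Complex.sub_re, Complex.re_ofReal_mul, Complex.ofReal_re, hE]
      linear_combination α * hcross
  · have hI₁ : 0 ≤ ∫ s in (0 : ℝ)..1, ‖iteratedDeriv 2 v s - iteratedDeriv 2 w s‖ ^ 2 :=
      intervalIntegral.integral_nonneg zero_le_one fun _ _ => by positivity
    have hI₂ : 0 ≤ ∫ s in (0 : ℝ)..1, ‖v s - w s‖ ^ 2 :=
      intervalIntegral.integral_nonneg zero_le_one fun _ _ => by positivity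
    have nonneg {k j : ℝ} (hk : 0 ≤ k) (hj : 0 ≤ j) (z : ℂ) : 0 ≤ (k + α * j) * ‖z‖ ^ 2 := by
      positivity
    linarith [mul_nonneg hα.le hI₁, mul_nonneg hδ hI₂, nonneg h04 h03 (v 0 - w 0),
      nonneg h02 h01 (deriv v 0 - deriv w 0), nonneg h14 h13 (v 1 - w 1),
      nonneg h12 h11 (deriv v 1 - deriv w 1)]
end

section
/- Let α > 0 and let (ρ_n) be any sequence of complex numbers for which there is a constant C₀ with |ρ_n − (n + 1/2)π ω₂| ≤ C₀/n for all n ≥ 1, and set λ_n = α ρ_n⁴. Then Re λ_n → −∞ as n → ∞, there are constants C and N with |Im λ_n| ≤ C·n² for n ≥ N, and for all sufficiently large n one has Re λ_n < 0 and |Im λ_n| ≤ |Re λ_n|; in particular the λ_n eventually lie in the sector {z ∈ ℂ : |Im z| ≤ |Re z|, Re z ≤ 0}. -/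
open Filter

/-- `ω₂ = e^{5πi/4}`. -/
noncomputable def ω2 : ℂ := Complex.exp (5 * Real.pi * Complex.I / 4)

theorem ω2_pow_four : ω2 ^ 4 = -1 := by
  rw [ω2, ← Complex.exp_nat_mul,
    show ((4 : ℕ) : ℂ) * (5 * Real.pi * Complex.I / 4) =
      Real.pi * Complex.I + (2 : ℤ) * (2 * Real.pi * Complex.I) by push_cast; ring,
    Complex.exp_add, Complex.exp_int_mul_two_pi_mul_I, Complex.exp_pi_mul_I, mul_one]

theorem norm_ω2 : ‖ω2‖ = 1 := by
  rw [ω2, show (5 * Real.pi * Complex.I / 4 : ℂ) = ((5 * Real.pi / 4 : ℝ) : ℂ) * Complex.I by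
    push_cast; ring, Complex.norm_exp_ofReal_mul_I]

theorem norm_pow_four_sub_pow_four_le {x y : ℂ} {M : ℝ} (hx : ‖x‖ ≤ M) (hy : ‖y‖ ≤ M) :
    ‖x ^ 4 - y ^ 4‖ ≤ ‖x - y‖ * (4 * M ^ 3) := by
  have hM : 0 ≤ M := (norm_nonneg x).trans hx
  rw [show x ^ 4 - y ^ 4 = (x - y) * (x ^ 3 + x ^ 2 * y + x * y ^ 2 + y ^ 3) by ring, norm_mul]
  gcongr
  calc ‖x ^ 3 + x ^ 2 * y + x * y ^ 2 + y ^ 3‖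
      ≤ ‖x ^ 3‖ + ‖x ^ 2 * y‖ + ‖x * y ^ 2‖ + ‖y ^ 3‖ := norm_add₄_le
    _ = ‖x‖ ^ 3 + ‖x‖ ^ 2 * ‖y‖ + ‖x‖ * ‖y‖ ^ 2 + ‖y‖ ^ 3 := by simp only [norm_mul, norm_pow]
    _ ≤ M ^ 3 + M ^ 2 * M + M * M ^ 2 + M ^ 3 := by gcongr
    _ = 4 * M ^ 3 := by ring

/-- If `ρₙ = (n + 1/2)πω₂ + O(1/n)`, then `ρₙ⁴ = -((n + 1/2)π)⁴ + O(n²)`. -/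
theorem exists_norm_pow_four_add_le (ρ : ℕ → ℂ)
    (h : ∃ C₀ : ℝ, ∀ n : ℕ, 1 ≤ n →
      ‖ρ n - (((n : ℂ) + 1 / 2) * Real.pi) * ω2‖ ≤ C₀ / (n : ℝ)) :
    ∃ K : ℝ, 0 ≤ K ∧ ∀ n : ℕ, 1 ≤ n →
      ‖ρ n ^ 4 + (((((n : ℝ) + 1 / 2) * Real.pi) ^ 4 : ℝ) : ℂ)‖ ≤ K * (n : ℝ) ^ 2 := by
  obtain ⟨C, hC⟩ := h
  have hC0 : 0 ≤ C := by simpa using (norm_nonneg _).trans (hC 1 le_rfl)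
  refine ⟨4 * C * (6 + C) ^ 3, by positivity, fun n hn ↦ ?_⟩
  have hn' : (1 : ℝ) ≤ n := by exact_mod_cast hn
  set y : ℂ := (((n : ℂ) + 1 / 2) * Real.pi) * ω2 with hy
  have hynorm : ‖y‖ ≤ 6 * n := by
    have hy_eq : ‖y‖ = ((n : ℝ) + 1 / 2) * Real.pi := by
      rw [hy, norm_mul, norm_ω2, mul_one,
        show ((n : ℂ) + 1 / 2) * Real.pi = ((((n : ℝ) + 1 / 2) * Real.pi : ℝ) : ℂ) by
          push_cast; ring, Complex.norm_of_nonneg (by positivity)]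
    rw [hy_eq]
    nlinarith [Real.pi_le_four]
  have hsub : ‖ρ n - y‖ ≤ C / n := hC n hn
  have hdiv : C / n ≤ C * n := by
    rw [div_le_iff₀ (by positivity)]
    nlinarith [mul_nonneg hC0 (by nlinarith : (0 : ℝ) ≤ n * n - 1)]
  have hρ : ‖ρ n‖ ≤ (6 + C) * n := by
    linarith [norm_le_norm_add_norm_sub' (ρ n) y]
  have hyM : ‖y‖ ≤ (6 + C) * n := by nlinarith
  have hpow : y ^ 4 = -(((((n : ℝ) + 1 / 2) * Real.pi) ^ 4 : ℝ) : ℂ) := by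
    rw [hy, mul_pow, ω2_pow_four]
    push_cast
    ring
  calc ‖ρ n ^ 4 + (((((n : ℝ) + 1 / 2) * Real.pi) ^ 4 : ℝ) : ℂ)‖ = ‖ρ n ^ 4 - y ^ 4‖ := by
        rw [hpow, sub_neg_eq_add]
    _ ≤ ‖ρ n - y‖ * (4 * ((6 + C) * n) ^ 3) := norm_pow_four_sub_pow_four_le hρ hyM
    _ ≤ C / n * (4 * ((6 + C) * n) ^ 3) := by gcongr
    _ = 4 * C * (6 + C) ^ 3 * (n : ℝ) ^ 2 := by field_simp

/-- if `ρₙ = (n+1/2)πω₂ + O(1/n)` and `λₙ = αρₙ⁴` with `α > 0`, then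
`Re λₙ → −∞`, `|Im λₙ| = O(n²)`, and eventually `Re λₙ < 0` and `|Im λₙ| ≤ |Re λₙ|`; in
particular the `λₙ` eventually lie in the sector `{z : |Im z| ≤ |Re z|, Re z ≤ 0}`. -/
theorem eigenvalues_in_sector (α : ℝ) (hα : 0 < α) (ρ : ℕ → ℂ)
    (h : ∃ C₀ : ℝ, ∀ n : ℕ, 1 ≤ n →
      ‖ρ n - (((n : ℂ) + 1 / 2) * Real.pi) * ω2‖ ≤ C₀ / (n : ℝ)) :
    Tendsto (fun n : ℕ => ((α : ℂ) * (ρ n) ^ 4).re) atTop atBot ∧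
    (∃ C : ℝ, ∃ N : ℕ, ∀ n : ℕ, N ≤ n →
      |((α : ℂ) * (ρ n) ^ 4).im| ≤ C * (n : ℝ) ^ 2) ∧
    (∃ N : ℕ, ∀ n : ℕ, N ≤ n →
      ((α : ℂ) * (ρ n) ^ 4).re < 0 ∧
      |((α : ℂ) * (ρ n) ^ 4).im| ≤ |((α : ℂ) * (ρ n) ^ 4).re| ∧
      (α : ℂ) * (ρ n) ^ 4 ∈ {z : ℂ | |z.im| ≤ |z.re| ∧ z.re ≤ 0}) := by
  obtain ⟨K, hK, hbound⟩ := exists_norm_pow_four_add_le ρ h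
  have him : ∀ n : ℕ, 1 ≤ n → |((α : ℂ) * (ρ n) ^ 4).im| ≤ α * K * (n : ℝ) ^ 2 := by
    intro n hn
    have := (Complex.abs_im_le_norm _).trans (hbound n hn)
    rw [Complex.add_im, Complex.ofReal_im, add_zero] at this
    rw [Complex.im_ofReal_mul, abs_mul, abs_of_pos hα, mul_assoc]
    gcongr
  obtain ⟨N, hN⟩ := exists_nat_ge (2 * K + 1)
  have hN1 : 1 ≤ N := by
    have : (1 : ℝ) ≤ N := by linarith
    exact_mod_cast this
  have hre : ∀ n : ℕ, N ≤ n → ((α : ℂ) * (ρ n) ^ 4).re ≤ -(α * (K + 1) * (n : ℝ) ^ 2) := by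
    intro n hn
    have hn1 : (1 : ℝ) ≤ n := by exact_mod_cast hN1.trans hn
    have hnN : (N : ℝ) ≤ n := by exact_mod_cast hn
    have hdist := (Complex.re_le_norm _).trans (hbound n (hN1.trans hn))
    rw [Complex.add_re, Complex.ofReal_re] at hdist
    have hmain : (n : ℝ) ^ 4 ≤ (((n : ℝ) + 1 / 2) * Real.pi) ^ 4 := by
      gcongr
      nlinarith [Real.pi_gt_three]
    have hsq : (2 * K + 1) * (n : ℝ) ^ 2 ≤ (n : ℝ) ^ 4 := by
      rw [show (n : ℝ) ^ 4 = (n : ℝ) ^ 2 * (n : ℝ) ^ 2 by ring]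
      gcongr
      nlinarith
    rw [Complex.re_ofReal_mul, mul_assoc, ← mul_neg]
    gcongr
    linarith
  refine ⟨?_, ⟨α * K, 1, him⟩, N, fun n hn ↦ ?_⟩
  · refine tendsto_atBot_mono' atTop ((eventually_ge_atTop N).mono hre) ?_
    refine tendsto_neg_atTop_atBot.comp (Tendsto.const_mul_atTop (by positivity) ?_)
    exact (tendsto_pow_atTop two_ne_zero).comp tendsto_natCast_atTop_atTop
  · have hn1 : (0 : ℝ) < n := by exact_mod_cast hN1.trans hn
    have hneg : ((α : ℂ) * (ρ n) ^ 4).re < 0 :=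
      (hre n hn).trans_lt (neg_neg_of_pos (by positivity))
    have hle : |((α : ℂ) * (ρ n) ^ 4).im| ≤ |((α : ℂ) * (ρ n) ^ 4).re| := by
      rw [abs_of_neg hneg]
      have : 0 < α * (n : ℝ) ^ 2 := by positivity
      linarith [him n (hN1.trans hn), hre n hn]
    exact ⟨hneg, hle, hle, hneg.le⟩
end
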